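/- Let n ≥ 1, let d ≥ 2 be even, and set N = binom(d/2 + n − 1, n − 1). For every positive semidefinite real symmetric N×N matrix G with spectral norm ‖G‖_σ = max_i |λ_i(G)| ≤ 1, the sum of squares form f(x) = m_{d/2}(x)ᵗ G m_{d/2}(x) satisfies v(f) ≥ π^{n/2}/Γ(n/2+1), and equality holds if and only if f = b_{d,n}. -/

import Mathlib

open MvPolynomial MeasureTheory Real Finset Matrix

/-- `v(f)`: the Lebesgue volume of the sublevel set `{x ∈ ℝⁿ : f(x) ≤ 1}`. -/
noncomputable def sublevelVol (n : ℕ) (f : MvPolynomial (Fin n) ℝ) : ENNReal :=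
  volume {x : Fin n → ℝ | eval x f ≤ 1}

/-- `b_{d,n}(x) = (x₁² + ⋯ + x_n²)^{d/2}`. -/
noncomputable def ballForm (n d : ℕ) : MvPolynomial (Fin n) ℝ :=
  (∑ i : Fin n, X i ^ 2) ^ (d / 2)

/-- `π^{n/2} / Γ(n/2 + 1)`, the volume of the unit Euclidean ball in `ℝⁿ`. -/
noncomputable def unitBallVol (n : ℕ) : ℝ :=
  π ^ ((n : ℝ) / 2) / Real.Gamma ((n : ℝ) / 2 + 1)

/-- `μ` enumerates (with respect to some fixed total order) the multi-indices
`α` of degree `k` in `n` variables. -/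
def IsMonomialEnum (n k : ℕ) {N : ℕ} (μ : Fin N → (Fin n →₀ ℕ)) : Prop :=
  Function.Injective μ ∧ (∀ i, ∑ j, μ i j = k) ∧
    ∀ α : Fin n →₀ ℕ, (∑ j, α j) = k → ∃ i, μ i = α

/-- The `i`-th rescaled monomial `√(k choose α) x^α` (with `α = μ i`) as a polynomial,
i.e. the `i`-th entry of the vector `m_k(x)`. -/
noncomputable def mPoly (n : ℕ) {N : ℕ} (μ : Fin N → (Fin n →₀ ℕ)) (i : Fin N) :
    MvPolynomial (Fin n) ℝ :=
  C (Real.sqrt ((μ i).multinomial)) * monomial (μ i) 1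

/-- The form `f(x) = m_k(x)ᵗ G m_k(x)` associated with a matrix `G`. -/
noncomputable def gramForm (n : ℕ) {N : ℕ} (μ : Fin N → (Fin n →₀ ℕ))
    (G : Matrix (Fin N) (Fin N) ℝ) : MvPolynomial (Fin n) ℝ :=
  ∑ i, ∑ j, C (G i j) * mPoly n μ i * mPoly n μ j

/-- A Hermitian matrix whose eigenvalues are at most `1` is dominated by the identity. -/
lemma Matrix.IsHermitian.dotProduct_mulVec_le_of_eigenvalues_le_one {ι : Type*} [Fintype ι]
    [DecidableEq ι] {A : Matrix ι ι ℝ} (hA : A.IsHermitian) (h : ∀ i, hA.eigenvalues i ≤ 1)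
    (v : ι → ℝ) : v ⬝ᵥ (A *ᵥ v) ≤ v ⬝ᵥ v := by
  have hU : (hA.eigenvectorUnitary : Matrix ι ι ℝ) * (hA.eigenvectorUnitary : Matrix ι ι ℝ)ᴴ = 1 :=
    Unitary.coe_mul_star_self hA.eigenvectorUnitary
  have hsub : 1 - A = (hA.eigenvectorUnitary : Matrix ι ι ℝ) *
      diagonal (fun i => 1 - hA.eigenvalues i) * (hA.eigenvectorUnitary : Matrix ι ι ℝ)ᴴ := by
    have hD : diagonal (fun i => 1 - hA.eigenvalues i)
        = 1 - diagonal (RCLike.ofReal ∘ hA.eigenvalues : ι → ℝ) := by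
      rw [← diagonal_one, diagonal_sub]; rfl
    conv_lhs => rw [hA.spectral_theorem]
    rw [Unitary.conjStarAlgAut_apply, hD, mul_sub, sub_mul, mul_one, hU]
    rfl
  have hP : (1 - A).PosSemidef := by
    rw [hsub]
    exact (posSemidef_diagonal_iff.2 fun i => sub_nonneg.2 (h i)).mul_mul_conjTranspose_same _
  have := hP.dotProduct_mulVec_nonneg v
  rw [sub_mulVec, one_mulVec, dotProduct_sub, star_trivial] at this
  linarith

lemma eval_mPoly (n : ℕ) {N : ℕ} (μ : Fin N → (Fin n →₀ ℕ)) (i : Fin N) (x : Fin n → ℝ) :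
    eval x (mPoly n μ i) = √((μ i).multinomial) * ∏ j, x j ^ μ i j := by
  simp [mPoly, eval_monomial, Finsupp.prod_fintype]

lemma eval_gramForm (n : ℕ) {N : ℕ} (μ : Fin N → (Fin n →₀ ℕ)) (G : Matrix (Fin N) (Fin N) ℝ)
    (x : Fin n → ℝ) :
    eval x (gramForm n μ G) =
      (fun i => eval x (mPoly n μ i)) ⬝ᵥ (G *ᵥ fun i => eval x (mPoly n μ i)) := by
  simp only [gramForm, map_sum, map_mul, eval_C, dotProduct, mulVec, Finset.mul_sum]
  exact Finset.sum_congr rfl fun i _ => Finset.sum_congr rfl fun j _ => by ring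

lemma eval_ballForm (n d : ℕ) (x : Fin n → ℝ) :
    eval x (ballForm n d) = (∑ i, x i ^ 2) ^ (d / 2) := by
  simp [ballForm]

/-- The multinomial theorem: `m_k(x)ᵗ m_k(x) = (x₁² + ⋯ + x_n²)^k`. -/
lemma IsMonomialEnum.sum_eval_mPoly_mul_self {n k N : ℕ} {μ : Fin N → (Fin n →₀ ℕ)}
    (hμ : IsMonomialEnum n k μ) (x : Fin n → ℝ) :
    (fun i => eval x (mPoly n μ i)) ⬝ᵥ (fun i => eval x (mPoly n μ i)) =
      (∑ i, x i ^ 2) ^ k := by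
  obtain ⟨hinj, hdeg, hsurj⟩ := hμ
  rw [Finset.sum_pow_eq_sum_piAntidiag, dotProduct]
  refine Finset.sum_bij (fun i _ => ⇑(μ i)) (fun i _ => by simp [hdeg i])
    (fun i _ j _ h => hinj (DFunLike.coe_injective h)) (fun α hα => ?_) (fun i _ => ?_)
  · obtain ⟨i, hi⟩ := hsurj (Finsupp.equivFunOnFinite.symm α) (by simpa using hα)
    exact ⟨i, Finset.mem_univ i, by rw [hi]; rfl⟩
  · rw [eval_mPoly, mul_mul_mul_comm, Real.mul_self_sqrt (Nat.cast_nonneg _),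
      Finsupp.multinomial_eq_of_support_subset (Finset.subset_univ _), ← Finset.prod_mul_distrib]
    congr 1
    exact Finset.prod_congr rfl fun j _ => by ring

lemma IsMonomialEnum.eval_smul_gramForm {n k N : ℕ} {μ : Fin N → (Fin n →₀ ℕ)}
    (hμ : IsMonomialEnum n k μ) (G : Matrix (Fin N) (Fin N) ℝ) (t : ℝ) (x : Fin n → ℝ) :
    eval (t • x) (gramForm n μ G) = t ^ (2 * k) * eval x (gramForm n μ G) := by
  have hm : (fun i => eval (t • x) (mPoly n μ i)) = t ^ k • fun i => eval x (mPoly n μ i) := by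
    ext i
    simp only [eval_mPoly, Pi.smul_apply, smul_eq_mul, mul_pow, Finset.prod_mul_distrib,
      Finset.prod_pow_eq_pow_sum, hμ.2.1 i]
    ring
  rw [eval_gramForm, eval_gramForm, hm, mulVec_smul, smul_dotProduct, dotProduct_smul,
    smul_eq_mul, smul_eq_mul]
  ring

lemma eval_smul_ballForm (n d : ℕ) (t : ℝ) (x : Fin n → ℝ) :
    eval (t • x) (ballForm n d) = t ^ (2 * (d / 2)) * eval x (ballForm n d) := by
  simp only [eval_ballForm, Pi.smul_apply, smul_eq_mul, mul_pow, ← Finset.mul_sum]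
  rw [← pow_mul]

lemma sublevelVol_ballForm {n d : ℕ} (hn : 1 ≤ n) (hd : 2 ≤ d) :
    sublevelVol n (ballForm n d) = ENNReal.ofReal (unitBallVol n) := by
  have : Nonempty (Fin n) := ⟨⟨0, hn⟩⟩
  have hset : {x : Fin n → ℝ | eval x (ballForm n d) ≤ 1} =
      WithLp.toLp 2 ⁻¹' Metric.closedBall (0 : EuclideanSpace ℝ (Fin n)) 1 := by
    ext x
    have h0 : 0 ≤ ∑ i, x i ^ 2 := Finset.sum_nonneg fun i _ => sq_nonneg _
    simp only [Set.mem_ofPred_eq, eval_ballForm, Set.mem_preimage, mem_closedBall_zero_iff,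
      EuclideanSpace.norm_eq, Real.norm_eq_abs, sq_abs, Real.sqrt_le_iff,
      zero_le_one, one_pow, true_and]
    exact pow_le_one_iff_of_nonneg h0 (Nat.div_pos hd two_pos).ne'
  rw [sublevelVol, hset, (PiLp.volume_preserving_toLp (Fin n)).measure_preimage
    Metric.isClosed_closedBall.measurableSet.nullMeasurableSet, EuclideanSpace.volume_closedBall,
    unitBallVol, Fintype.card_fin, ENNReal.ofReal_one, one_pow, one_mul, Real.sqrt_eq_rpow,
    ← Real.rpow_natCast, ← Real.rpow_mul Real.pi_nonneg, one_div_mul_eq_div]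

/-- Every positive semidefinite `G` with spectral norm `max_i |λ_i(G)| ≤ 1` yields a sum of
squares `f(x) = m_{d/2}(x)ᵗ G m_{d/2}(x)` with `v(f) ≥ π^{n/2}/Γ(n/2+1)`,
and equality iff `f = b_{d,n}`. -/
theorem stmt9 (n d N : ℕ) (hn : 1 ≤ n) (hd : 2 ≤ d) (hdeven : Even d)
    (hN : N = Nat.choose (d / 2 + n - 1) (n - 1))
    (μ : Fin N → (Fin n →₀ ℕ)) (hμ : IsMonomialEnum n (d / 2) μ) :
    ∀ (G : Matrix (Fin N) (Fin N) ℝ) (hG : G.PosSemidef),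
      (∀ i, |hG.1.eigenvalues i| ≤ 1) →
      ENNReal.ofReal (unitBallVol n) ≤ sublevelVol n (gramForm n μ G) ∧
      (sublevelVol n (gramForm n μ G) = ENNReal.ofReal (unitBallVol n) ↔
        gramForm n μ G = ballForm n d) := by
  intro G hG hev
  have hle : ∀ x, eval x (gramForm n μ G) ≤ eval x (ballForm n d) := fun x => by
    rw [eval_gramForm, eval_ballForm, ← hμ.sum_eval_mPoly_mul_self x]
    exact hG.1.dotProduct_mulVec_le_of_eigenvalues_le_one (fun i => (abs_le.1 (hev i)).2) _
  have hsub : {x : Fin n → ℝ | eval x (ballForm n d) ≤ 1} ⊆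
      {x : Fin n → ℝ | eval x (gramForm n μ G) ≤ 1} := fun x hx => (hle x).trans hx
  have hball := sublevelVol_ballForm hn hd
  refine ⟨hball ▸ measure_mono hsub, fun heq => ?_, fun h => h ▸ hball⟩
  by_contra hne
  obtain ⟨x, hx⟩ : ∃ x, eval x (gramForm n μ G) ≠ eval x (ballForm n d) := by
    by_contra! hall
    exact hne (MvPolynomial.funext hall)
  obtain ⟨c, hfc, hcb⟩ := exists_between (lt_of_le_of_ne (hle x) hx)
  have hf0 : 0 ≤ eval x (gramForm n μ G) := by
    rw [eval_gramForm]
    simpa using hG.dotProduct_mulVec_nonneg fun i => eval x (mPoly n μ i)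
  have hc : 0 < c := hf0.trans_lt hfc
  obtain ⟨t, ht⟩ : ∃ t : ℝ, t ^ (2 * (d / 2)) = c⁻¹ :=
    ⟨_, Real.rpow_inv_natCast_pow (inv_nonneg.2 hc.le) (by omega)⟩
  set U := {y : Fin n → ℝ | eval y (gramForm n μ G) < 1 ∧ 1 < eval y (ballForm n d)}
  have hU : IsOpen U := (isOpen_lt (MvPolynomial.continuous_eval _) continuous_const).inter
    (isOpen_lt continuous_const (MvPolynomial.continuous_eval _))
  have hUne : U.Nonempty := by
    refine ⟨t • x, ?_, ?_⟩
    · rw [hμ.eval_smul_gramForm, ht, inv_mul_lt_one₀ hc]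
      exact hfc
    · rw [eval_smul_ballForm, ht, one_lt_inv_mul₀ hc]
      exact hcb
  have hdisj : Disjoint {x : Fin n → ℝ | eval x (ballForm n d) ≤ 1} U :=
    Set.disjoint_left.2 fun y hy hyU => not_lt.2 hy hyU.2
  have hunion : sublevelVol n (ballForm n d) + volume U ≤ sublevelVol n (gramForm n μ G) := by
    rw [sublevelVol, ← measure_union hdisj hU.measurableSet]
    exact measure_mono (Set.union_subset hsub fun y hy => hy.1.le)
  rw [heq, hball] at hunion
  have hpos := hU.measure_pos volume hUne
  exact (ENNReal.lt_add_right ENNReal.ofReal_ne_top hpos.ne').not_ge hunion
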